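/- Closed-form TV between univariate Gaussians with distinct variances: Let p₁ and p₂ be the density functions of the Gaussian distributions N(μ₁, σ₁²) and N(μ₂, σ₂²) with σ₁, σ₂ > 0 and σ₁ ≠ σ₂. Set a = 1/σ₁² − 1/σ₂², b = 2(μ₂/σ₂² − μ₁/σ₁²), c = (μ₁/σ₁)² − (μ₂/σ₂)² + 2 log(σ₁/σ₂), and Δ = b² − 4ac. Then Δ ≥ 0, and with x₁ = (−b − √Δ)/(2a) and x₂ = (−b + √Δ)/(2a), the total variation distance is TV(p₁, p₂) = |Φ₁(x₁) − Φ₂(x₁)| + |Φ₁(x₂) − Φ₂(x₂)|, where Φ₁ and Φ₂ are the cumulative distribution functions of N(μ₁, σ₁²) and N(μ₂, σ₂²). -/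

import Mathlib

open MeasureTheory Real

/-- A function with vanishing integral which is nonpositive outside `[u, v]` and nonnegative
inside has half its `L¹` norm given by the values of its primitive at `u` and `v`. -/
theorem half_integral_abs_eq_of_sign_changes {f : ℝ → ℝ} (hf : Integrable f)
    (hf0 : ∫ x, f x = 0) {u v : ℝ} (huv : u ≤ v) (hleft : ∀ x ≤ u, f x ≤ 0)
    (hmid : ∀ x, u ≤ x → x ≤ v → 0 ≤ f x) (hright : ∀ x, v ≤ x → f x ≤ 0) :
    (1 / 2) * (∫ x, |f x|) = |∫ x in Set.Iic u, f x| + |∫ x in Set.Iic v, f x| := by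
  have hsplit : ∀ g : ℝ → ℝ, Integrable g →
      (∫ x, g x) = (∫ x in Set.Iic v, g x) + ∫ x in Set.Ioi v, g x := fun g hg =>
    (intervalIntegral.integral_Iic_add_Ioi hg.integrableOn hg.integrableOn).symm
  have hsplit' : ∀ g : ℝ → ℝ, Integrable g →
      (∫ x in Set.Iic v, g x) = (∫ x in Set.Iic u, g x) + ∫ x in Set.Ioc u v, g x := by
    intro g hg
    rw [← Set.Iic_union_Ioc_eq_Iic huv]
    exact setIntegral_union (Set.Iic_disjoint_Ioc le_rfl) measurableSet_Ioc hg.integrableOn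
      hg.integrableOn
  have hl : (∫ x in Set.Iic u, |f x|) = -∫ x in Set.Iic u, f x := by
    rw [← integral_neg]
    exact setIntegral_congr_fun measurableSet_Iic fun x hx => abs_of_nonpos (hleft x hx)
  have hm : (∫ x in Set.Ioc u v, |f x|) = ∫ x in Set.Ioc u v, f x :=
    setIntegral_congr_fun measurableSet_Ioc fun x hx => abs_of_nonneg (hmid x hx.1.le hx.2)
  have hr : (∫ x in Set.Ioi v, |f x|) = -∫ x in Set.Ioi v, f x := by
    rw [← integral_neg]
    exact setIntegral_congr_fun measurableSet_Ioi fun x hx => abs_of_nonpos (hright x (le_of_lt hx))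
  have hl0 : (∫ x in Set.Iic u, f x) ≤ 0 :=
    setIntegral_nonpos measurableSet_Iic hleft
  have hr0 : (∫ x in Set.Ioi v, f x) ≤ 0 :=
    setIntegral_nonpos measurableSet_Ioi fun x hx => hright x (le_of_lt hx)
  have h1 := hsplit f hf
  have h2 := hsplit _ hf.abs
  have h3 := hsplit' f hf
  have h4 := hsplit' _ hf.abs
  rw [abs_of_nonpos hl0, abs_of_nonneg (by linarith)]
  linarith

/-- The explicit Gaussian density with standard deviation `σ` is Mathlib's `gaussianPDFReal`. -/
theorem gaussian_density_eq_gaussianPDFReal (μ : ℝ) {σ : ℝ} (hσ : 0 < σ) :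
    (fun x => (1 / (σ * √(2 * π))) * exp (-(x - μ)^2 / (2 * σ^2))) =
      ProbabilityTheory.gaussianPDFReal μ ⟨σ^2, sq_nonneg σ⟩ := by
  funext x
  have h : √(2 * π * σ^2) = σ * √(2 * π) := by
    rw [sqrt_mul (by positivity), sqrt_sq hσ.le, mul_comm]
  change _ = (√(2 * π * σ^2))⁻¹ * exp (-(x - μ)^2 / (2 * σ^2))
  rw [h, one_div]

theorem integrable_gaussian_density (μ : ℝ) {σ : ℝ} (hσ : 0 < σ) :
    Integrable fun x => (1 / (σ * √(2 * π))) * exp (-(x - μ)^2 / (2 * σ^2)) := by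
  rw [gaussian_density_eq_gaussianPDFReal μ hσ]
  exact ProbabilityTheory.integrable_gaussianPDFReal _ _

theorem integral_gaussian_density (μ : ℝ) {σ : ℝ} (hσ : 0 < σ) :
    ∫ x, (1 / (σ * √(2 * π))) * exp (-(x - μ)^2 / (2 * σ^2)) = 1 := by
  rw [gaussian_density_eq_gaussianPDFReal μ hσ]
  refine ProbabilityTheory.integral_gaussianPDFReal_eq_one μ fun h => ?_
  exact (pow_pos hσ 2).ne' (congrArg NNReal.toReal h)

theorem gaussian_density_eq_exp (μ x : ℝ) {σ : ℝ} (hσ : 0 < σ) :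
    (1 / (σ * √(2 * π))) * exp (-(x - μ)^2 / (2 * σ^2)) =
      (1 / √(2 * π)) * exp (-(x - μ)^2 / (2 * σ^2) - log σ) := by
  rw [exp_sub, exp_log hσ]
  field_simp

/-- Comparing two Gaussian densities amounts to the sign of a quadratic polynomial. -/
theorem gaussian_density_le_iff (μ₁ μ₂ x : ℝ) {σ₁ σ₂ : ℝ} (hσ₁ : 0 < σ₁) (hσ₂ : 0 < σ₂) :
    (1 / (σ₁ * √(2 * π))) * exp (-(x - μ₁)^2 / (2 * σ₁^2)) ≤
        (1 / (σ₂ * √(2 * π))) * exp (-(x - μ₂)^2 / (2 * σ₂^2)) ↔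
      0 ≤ (1 / σ₁^2 - 1 / σ₂^2) * x^2 + 2 * (μ₂ / σ₂^2 - μ₁ / σ₁^2) * x +
        ((μ₁ / σ₁)^2 - (μ₂ / σ₂)^2 + 2 * log (σ₁ / σ₂)) := by
  rw [gaussian_density_eq_exp μ₁ x hσ₁, gaussian_density_eq_exp μ₂ x hσ₂,
    mul_le_mul_iff_right₀ (by positivity), exp_le_exp, log_div hσ₁.ne' hσ₂.ne', ← sub_nonneg]
  have h : (1 / σ₁^2 - 1 / σ₂^2) * x^2 + 2 * (μ₂ / σ₂^2 - μ₁ / σ₁^2) * x +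
        ((μ₁ / σ₁)^2 - (μ₂ / σ₂)^2 + 2 * (log σ₁ - log σ₂)) =
      2 * ((-(x - μ₂)^2 / (2 * σ₂^2) - log σ₂) - (-(x - μ₁)^2 / (2 * σ₁^2) - log σ₁)) := by
    field_simp
    ring
  rw [h]
  constructor <;> intro h' <;> linarith

theorem one_div_sq_sub_mul_log_nonpos {σ₁ σ₂ : ℝ} (hσ₁ : 0 < σ₁) (hσ₂ : 0 < σ₂) :
    (1 / σ₁^2 - 1 / σ₂^2) * log (σ₁ / σ₂) ≤ 0 := by
  rcases le_total σ₁ σ₂ with h | h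
  · exact mul_nonpos_of_nonneg_of_nonpos (sub_nonneg.2 (by gcongr))
      (log_nonpos (by positivity) ((div_le_one hσ₂).2 h))
  · exact mul_nonpos_of_nonpos_of_nonneg (sub_nonpos.2 (by gcongr))
      (log_nonneg ((one_le_div hσ₂).2 h))

/-- Closed-form total variation distance between two univariate Gaussian densities with
distinct standard deviations `σ₁ ≠ σ₂`: with
`a = 1/σ₁² - 1/σ₂²`, `b = 2(μ₂/σ₂² - μ₁/σ₁²)`,
`c = (μ₁/σ₁)² - (μ₂/σ₂)² + 2 log (σ₁/σ₂)` and `Δ = b² - 4ac`, one has `Δ ≥ 0` and,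
for the roots `x₁ = (-b - √Δ)/(2a)` and `x₂ = (-b + √Δ)/(2a)`,
`TV(p₁, p₂) = |Φ₁(x₁) - Φ₂(x₁)| + |Φ₁(x₂) - Φ₂(x₂)|`. -/
theorem tv_gaussians_closed_form
    (μ₁ μ₂ σ₁ σ₂ : ℝ) (hσ₁ : 0 < σ₁) (hσ₂ : 0 < σ₂) (hσ : σ₁ ≠ σ₂)
    (p₁ p₂ : ℝ → ℝ)
    (hp₁ : p₁ = fun x => (1 / (σ₁ * Real.sqrt (2 * π))) * Real.exp (-(x - μ₁)^2 / (2 * σ₁^2)))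
    (hp₂ : p₂ = fun x => (1 / (σ₂ * Real.sqrt (2 * π))) * Real.exp (-(x - μ₂)^2 / (2 * σ₂^2)))
    (Φ₁ Φ₂ : ℝ → ℝ)
    (hΦ₁ : Φ₁ = fun t => ∫ x in Set.Iic t, p₁ x)
    (hΦ₂ : Φ₂ = fun t => ∫ x in Set.Iic t, p₂ x)
    (a b c Δ : ℝ)
    (ha : a = 1 / σ₁^2 - 1 / σ₂^2)
    (hb : b = 2 * (μ₂ / σ₂^2 - μ₁ / σ₁^2))
    (hc : c = (μ₁ / σ₁)^2 - (μ₂ / σ₂)^2 + 2 * Real.log (σ₁ / σ₂))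
    (hΔ : Δ = b^2 - 4 * a * c)
    (x₁ x₂ : ℝ)
    (hx₁ : x₁ = (-b - Real.sqrt Δ) / (2 * a))
    (hx₂ : x₂ = (-b + Real.sqrt Δ) / (2 * a)) :
    Δ ≥ 0 ∧
    (1 / 2) * (∫ x, |p₁ x - p₂ x|) =
      |Φ₁ x₁ - Φ₂ x₁| + |Φ₁ x₂ - Φ₂ x₂| := by
  have hΔ0 : 0 ≤ Δ := by
    have hlog := one_div_sq_sub_mul_log_nonpos hσ₁ hσ₂
    have h : Δ = 4 * ((μ₁ - μ₂) / (σ₁ * σ₂))^2 -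
        8 * ((1 / σ₁^2 - 1 / σ₂^2) * log (σ₁ / σ₂)) := by
      rw [hΔ, ha, hb, hc]
      field_simp
      ring
    have hsq := sq_nonneg ((μ₁ - μ₂) / (σ₁ * σ₂))
    linarith
  refine ⟨hΔ0, ?_⟩
  have ha0 : a ≠ 0 := by
    rw [ha, sub_ne_zero, Ne, one_div, one_div, inv_inj]
    exact fun h => hσ ((pow_left_inj₀ hσ₁.le hσ₂.le two_ne_zero).1 h)
  have hint₁ : Integrable p₁ := hp₁ ▸ integrable_gaussian_density μ₁ hσ₁
  have hint₂ : Integrable p₂ := hp₂ ▸ integrable_gaussian_density μ₂ hσ₂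
  have hone₁ : ∫ x, p₁ x = 1 := by rw [hp₁]; exact integral_gaussian_density μ₁ hσ₁
  have hone₂ : ∫ x, p₂ x = 1 := by rw [hp₂]; exact integral_gaussian_density μ₂ hσ₂
  have hfactor : ∀ x, a * x^2 + b * x + c = a * ((x - x₁) * (x - x₂)) := by
    intro x
    have hs := sq_sqrt hΔ0
    rw [hx₁, hx₂]
    field_simp
    linear_combination hs + hΔ
  have hle : ∀ x, p₁ x ≤ p₂ x ↔ 0 ≤ a * ((x - x₁) * (x - x₂)) := by
    intro x
    rw [← hfactor, hp₁, hp₂, ha, hb, hc]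
    exact gaussian_density_le_iff μ₁ μ₂ x hσ₁ hσ₂
  have hge : ∀ x, p₂ x ≤ p₁ x ↔ a * ((x - x₁) * (x - x₂)) ≤ 0 := by
    intro x
    have h := gaussian_density_le_iff μ₂ μ₁ x hσ₂ hσ₁
    rw [← inv_div σ₁ σ₂, log_inv] at h
    rw [← hfactor, hp₁, hp₂, ha, hb, hc]
    refine h.trans ?_
    constructor <;> intro h' <;> linarith
  have hΦ : ∀ t, Φ₁ t - Φ₂ t = ∫ x in Set.Iic t, (p₁ x - p₂ x) := by
    intro t
    rw [hΦ₁, hΦ₂]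
    exact (integral_sub hint₁.integrableOn hint₂.integrableOn).symm
  have hΦ' : ∀ t, Φ₂ t - Φ₁ t = ∫ x in Set.Iic t, (p₂ x - p₁ x) := by
    intro t
    rw [hΦ₁, hΦ₂]
    exact (integral_sub hint₂.integrableOn hint₁.integrableOn).symm
  rcases lt_or_gt_of_ne ha0 with hneg | hpos
  · have hx : x₂ ≤ x₁ := by
      rw [hx₁, hx₂]
      exact div_le_div_of_nonpos_of_le (by linarith) (by linarith [sqrt_nonneg Δ])
    simp_rw [abs_sub_comm (p₁ _), abs_sub_comm (Φ₁ _), hΦ']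
    rw [add_comm]
    refine half_integral_abs_eq_of_sign_changes (hint₂.sub hint₁)
      (by rw [integral_sub' hint₂ hint₁, hone₁, hone₂, sub_self]) hx (fun x hxu => ?_)
      (fun x hxu hxv => ?_) fun x hxv => ?_
    · exact sub_nonpos.2 ((hge x).2 (mul_nonpos_of_nonpos_of_nonneg hneg.le
        (mul_nonneg_of_nonpos_of_nonpos (by linarith) (by linarith))))
    · exact sub_nonneg.2 ((hle x).2 (mul_nonneg_of_nonpos_of_nonpos hneg.le
        (mul_nonpos_of_nonpos_of_nonneg (by linarith) (by linarith))))
    · exact sub_nonpos.2 ((hge x).2 (mul_nonpos_of_nonpos_of_nonneg hneg.le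
        (mul_nonneg (by linarith) (by linarith))))
  · have hx : x₁ ≤ x₂ := by
      rw [hx₁, hx₂]
      gcongr
      linarith [sqrt_nonneg Δ]
    simp_rw [hΦ]
    refine half_integral_abs_eq_of_sign_changes (hint₁.sub hint₂)
      (by rw [integral_sub' hint₁ hint₂, hone₁, hone₂, sub_self]) hx (fun x hxu => ?_)
      (fun x hxu hxv => ?_) fun x hxv => ?_
    · exact sub_nonpos.2 ((hle x).2 (mul_nonneg hpos.le
        (mul_nonneg_of_nonpos_of_nonpos (by linarith) (by linarith))))
    · exact sub_nonneg.2 ((hge x).2 (mul_nonpos_of_nonneg_of_nonpos hpos.le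
        (mul_nonpos_of_nonneg_of_nonpos (by linarith) (by linarith))))
    · exact sub_nonpos.2 ((hle x).2 (mul_nonneg hpos.le
        (mul_nonneg (by linarith) (by linarith))))
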